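/- arXiv:1109.6505 — 12 statements merged into one kernel-verified Lean document; each statement's English description precedes it below -/
import Mathlib

section
/- The Bellman operator T is a contraction with modulus Q/(Q+θ) in the sup norm: for all bounded measurable functions J₁, J₂ : ℝ × ℝ → ℝ, one has sup_{(s,w) ∈ [0,s̄]×[0,B]} |(TJ₁)(s,w) − (TJ₂)(s,w)| ≤ (Q/(Q+θ)) · sup_{(s,w) ∈ [0,s̄]×[0,B]} |J₁(s,w) − J₂(s,w)|. -/
open MeasureTheory

/-- The objective inside the Bellman operator:
`g(w-u) + ∫_0^∞ Q e^{-(Q+θ)t} (∫ J(min{s-u+rt, s̄}, w') dν(w')) dt`. -/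
noncomputable def bellmanObj (Q θ r sbar : ℝ) (ν : Measure ℝ) (g : ℝ → ℝ)
    (J : ℝ × ℝ → ℝ) (s w u : ℝ) : ℝ :=
  g (w - u) + ∫ t in Set.Ioi (0 : ℝ), Q * Real.exp (-(Q + θ) * t) *
      (∫ w', J (min (s - u + r * t) sbar, w') ∂ν)

/-- The Bellman operator `T`. -/
noncomputable def bellmanT (Q θ r sbar : ℝ) (ν : Measure ℝ) (g : ℝ → ℝ)
    (J : ℝ × ℝ → ℝ) : ℝ × ℝ → ℝ := fun sw =>
  sInf (bellmanObj Q θ r sbar ν g J sw.1 sw.2 '' Set.Icc 0 (min sw.1 sw.2))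

lemma bell_exp_int (Q θ : ℝ) (hQ : 0 < Q) (hθ : 0 < θ) :
    IntegrableOn (fun t : ℝ => Q * Real.exp (-(Q + θ) * t)) (Set.Ioi 0) :=
  (integrableOn_exp_mul_Ioi (by linarith) 0).const_mul Q

lemma bell_exp_val (Q θ : ℝ) (hQ : 0 < Q) (hθ : 0 < θ) :
    ∫ t in Set.Ioi (0 : ℝ), Q * Real.exp (-(Q + θ) * t) = Q / (Q + θ) := by
  rw [integral_const_mul, integral_exp_mul_Ioi (by linarith) 0]
  simp only [mul_zero, Real.exp_zero]
  have : Q + θ ≠ 0 := by positivity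
  field_simp

lemma bell_inner_meas (r sbar a : ℝ) (ν : Measure ℝ) [IsProbabilityMeasure ν]
    (J : ℝ × ℝ → ℝ) (hJ : Measurable J) :
    StronglyMeasurable (fun t : ℝ => ∫ w', J (min (a + r * t) sbar, w') ∂ν) := by
  have h : StronglyMeasurable (fun p : ℝ × ℝ => J (min (a + r * p.1) sbar, p.2)) :=
    (hJ.comp (by fun_prop : Measurable
      (fun p : ℝ × ℝ => (min (a + r * p.1) sbar, p.2)))).stronglyMeasurable
  exact h.integral_prod_right'

lemma bell_inner_int (x : ℝ) (ν : Measure ℝ) [IsProbabilityMeasure ν]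
    (J : ℝ × ℝ → ℝ) (hJ : Measurable J) (M : ℝ) (hM : ∀ x, |J x| ≤ M) :
    Integrable (fun w' => J (x, w')) ν :=
  Integrable.of_bound (hJ.comp (by fun_prop : Measurable
      (fun w' : ℝ => (x, w')))).aestronglyMeasurable M (.of_forall fun _ => hM _)

lemma bell_inner_bound (x : ℝ) (ν : Measure ℝ) [IsProbabilityMeasure ν]
    (J : ℝ × ℝ → ℝ) (M : ℝ) (hM : ∀ x, |J x| ≤ M) :
    |∫ w', J (x, w') ∂ν| ≤ M := by
  have := norm_integral_le_of_norm_le_const (μ := ν) (f := fun w' => J (x, w')) (C := M)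
    (.of_forall fun _ => hM _)
  simpa using this

lemma bell_outer_int (Q θ r sbar a : ℝ) (hQ : 0 < Q) (hθ : 0 < θ)
    (ν : Measure ℝ) [IsProbabilityMeasure ν]
    (J : ℝ × ℝ → ℝ) (hJ : Measurable J) (M : ℝ) (hM : ∀ x, |J x| ≤ M) :
    IntegrableOn (fun t : ℝ => Q * Real.exp (-(Q + θ) * t) *
      (∫ w', J (min (a + r * t) sbar, w') ∂ν)) (Set.Ioi 0) :=
  Integrable.mul_bdd (c := M) (bell_exp_int Q θ hQ hθ)
    (bell_inner_meas r sbar a ν J hJ).aestronglyMeasurable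
    (.of_forall fun _ => bell_inner_bound _ ν J M hM)

lemma bell_weight_bound (Q θ : ℝ) (hQ : 0 < Q) (hθ : 0 < θ) (f : ℝ → ℝ) (S : ℝ)
    (hf : ∀ t, 0 < t → |f t| ≤ S) :
    |∫ t in Set.Ioi (0 : ℝ), Q * Real.exp (-(Q + θ) * t) * f t| ≤ Q / (Q + θ) * S := by
  rw [← bell_exp_val Q θ hQ hθ, ← integral_mul_const]
  refine norm_integral_le_of_norm_le (f := fun t => Q * Real.exp (-(Q + θ) * t) * f t)
    ((bell_exp_int Q θ hQ hθ).mul_const S) ?_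
  filter_upwards [ae_restrict_mem measurableSet_Ioi] with t ht
  have h0 : 0 ≤ Q * Real.exp (-(Q + θ) * t) := by positivity
  rw [Real.norm_eq_abs, abs_mul, abs_of_nonneg h0]
  exact mul_le_mul_of_nonneg_left (hf t ht) h0

lemma bell_sInf_le (f₁ f₂ : ℝ → ℝ) (A : Set ℝ) (hA : A.Nonempty) (L c : ℝ)
    (hL : ∀ u ∈ A, L ≤ f₁ u) (h : ∀ u ∈ A, |f₁ u - f₂ u| ≤ c) :
    sInf (f₁ '' A) - sInf (f₂ '' A) ≤ c := by
  rw [sub_le_comm]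
  apply le_csInf (hA.image _)
  rintro _ ⟨u, hu, rfl⟩
  have h1 : sInf (f₁ '' A) ≤ f₁ u :=
    csInf_le ⟨L, by rintro _ ⟨v, hv, rfl⟩; exact hL v hv⟩ ⟨u, hu, rfl⟩
  have := (abs_le.mp (h u hu)).2
  linarith

lemma bell_obj_lower (Q θ r sbar : ℝ) (hQ : 0 < Q) (hθ : 0 < θ)
    (ν : Measure ℝ) [IsProbabilityMeasure ν] (g : ℝ → ℝ) (G : ℝ) (hG : ∀ x, |g x| ≤ G)
    (J : ℝ × ℝ → ℝ) (M : ℝ) (hM : ∀ x, |J x| ≤ M) (s w u : ℝ) :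
    -(G + Q / (Q + θ) * M) ≤ bellmanObj Q θ r sbar ν g J s w u := by
  have h1 := (abs_le.mp (hG (w - u))).1
  have h2 := (abs_le.mp (bell_weight_bound Q θ hQ hθ
    (fun t => ∫ w', J (min (s - u + r * t) sbar, w') ∂ν) M
    (fun t _ => bell_inner_bound _ ν J M hM))).1
  unfold bellmanObj
  linarith

theorem bellman_contraction
    (Q θ r sbar B : ℝ) (hQ : 0 < Q) (hθ : 0 < θ) (hr : 0 < r) (hsbar : 0 < sbar) (hB : 0 < B)
    (ν : Measure ℝ) [IsProbabilityMeasure ν] (hν : ν (Set.Icc 0 B) = 1)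
    (g : ℝ → ℝ) (hgm : Measurable g) (hgb : ∃ M, ∀ x, |g x| ≤ M)
    (J₁ : ℝ × ℝ → ℝ) (hJ₁m : Measurable J₁) (hJ₁b : ∃ M, ∀ x, |J₁ x| ≤ M)
    (J₂ : ℝ × ℝ → ℝ) (hJ₂m : Measurable J₂) (hJ₂b : ∃ M, ∀ x, |J₂ x| ≤ M) :
    sSup ((fun sw => |bellmanT Q θ r sbar ν g J₁ sw - bellmanT Q θ r sbar ν g J₂ sw|) ''
        (Set.Icc 0 sbar ×ˢ Set.Icc 0 B)) ≤
      (Q / (Q + θ)) *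
        sSup ((fun sw => |J₁ sw - J₂ sw|) '' (Set.Icc 0 sbar ×ˢ Set.Icc 0 B)) := by
  obtain ⟨G, hG⟩ := hgb
  obtain ⟨M₁, hM₁⟩ := hJ₁b
  obtain ⟨M₂, hM₂⟩ := hJ₂b
  set S := sSup ((fun sw => |J₁ sw - J₂ sw|) '' (Set.Icc 0 sbar ×ˢ Set.Icc 0 B)) with hS
  have hle : ∀ x ∈ Set.Icc 0 sbar, ∀ y ∈ Set.Icc 0 B, |J₁ (x, y) - J₂ (x, y)| ≤ S := by
    intro x hx y hy
    refine le_csSup ⟨M₁ + M₂, ?_⟩ ⟨(x, y), ⟨hx, hy⟩, rfl⟩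
    rintro _ ⟨p, _, rfl⟩
    exact (abs_sub _ _).trans (add_le_add (hM₁ p) (hM₂ p))
  have hae : ∀ᵐ y ∂ν, y ∈ Set.Icc 0 B := by
    exact (mem_ae_iff_prob_eq_one measurableSet_Icc).2 hν
  have hinner : ∀ x ∈ Set.Icc 0 sbar,
      |(∫ w', J₁ (x, w') ∂ν) - ∫ w', J₂ (x, w') ∂ν| ≤ S := by
    intro x hx
    rw [← integral_sub (bell_inner_int x ν J₁ hJ₁m M₁ hM₁) (bell_inner_int x ν J₂ hJ₂m M₂ hM₂)]
    have := norm_integral_le_of_norm_le_const (μ := ν)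
      (f := fun w' => J₁ (x, w') - J₂ (x, w')) (C := S)
      (hae.mono fun y hy => hle x hx y hy)
    simpa using this
  apply csSup_le
  · exact ⟨_, (0, 0), ⟨⟨le_rfl, hsbar.le⟩, ⟨le_rfl, hB.le⟩⟩, rfl⟩
  rintro _ ⟨⟨s, w⟩, ⟨hs, hw⟩, rfl⟩
  simp only [Set.mem_Icc] at hs hw
  have hobj : ∀ u ∈ Set.Icc 0 (min s w),
      |bellmanObj Q θ r sbar ν g J₁ s w u - bellmanObj Q θ r sbar ν g J₂ s w u|
        ≤ Q / (Q + θ) * S := by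
    intro u hu
    have hus : u ≤ s := hu.2.trans (min_le_left _ _)
    unfold bellmanObj
    rw [add_sub_add_left_eq_sub, ← integral_sub
      (bell_outer_int Q θ r sbar (s - u) hQ hθ ν J₁ hJ₁m M₁ hM₁)
      (bell_outer_int Q θ r sbar (s - u) hQ hθ ν J₂ hJ₂m M₂ hM₂)]
    simp only [← mul_sub]
    refine bell_weight_bound Q θ hQ hθ _ S fun t ht => hinner _ ⟨?_, min_le_right _ _⟩
    have : 0 ≤ r * t := by positivity
    exact le_min (by linarith) hsbar.le
  have hne : (Set.Icc 0 (min s w)).Nonempty := ⟨0, le_rfl, le_min hs.1 hw.1⟩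
  have h1 := bell_sInf_le _ _ _ hne _ _
    (fun u _ => bell_obj_lower Q θ r sbar hQ hθ ν g G hG J₁ M₁ hM₁ s w u) hobj
  have h2 := bell_sInf_le _ _ _ hne _ _
    (fun u _ => bell_obj_lower Q θ r sbar hQ hθ ν g G hG J₂ M₂ hM₂ s w u)
    (fun u hu => by rw [abs_sub_comm]; exact hobj u hu)
  simp only [bellmanT]
  exact abs_le.mpr ⟨by linarith, h1⟩
end

section
/- If the stage cost g is bounded and continuous and J : ℝ × ℝ → ℝ is bounded and continuous on [0,s̄] × [0,B], then TJ is continuous on [0,s̄] × [0,B], and for each (s,w) ∈ [0,s̄] × [0,B] the infimum defining (TJ)(s,w) is attained by some u ∈ [0, min{s,w}]. -/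
open MeasureTheory

theorem bellman_continuousOn_and_inf_attained
    (Q θ r sbar B : ℝ) (hQ : 0 < Q) (hθ : 0 < θ) (hr : 0 < r) (hsbar : 0 < sbar) (hB : 0 < B)
    (ν : Measure ℝ) [IsProbabilityMeasure ν] (hν : ν (Set.Icc 0 B) = 1)
    (g : ℝ → ℝ) (hgm : Measurable g) (hgb : ∃ M, ∀ x, |g x| ≤ M) (hgc : Continuous g)
    (J : ℝ × ℝ → ℝ) (hJm : Measurable J) (hJb : ∃ M, ∀ x, |J x| ≤ M)
    (hJc : ContinuousOn J (Set.Icc 0 sbar ×ˢ Set.Icc 0 B)) :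
    ContinuousOn (bellmanT Q θ r sbar ν g J) (Set.Icc 0 sbar ×ˢ Set.Icc 0 B) ∧
    ∀ sw ∈ Set.Icc 0 sbar ×ˢ Set.Icc 0 B,
      ∃ u ∈ Set.Icc 0 (min sw.1 sw.2),
        bellmanT Q θ r sbar ν g J sw = bellmanObj Q θ r sbar ν g J sw.1 sw.2 u := by
  obtain ⟨M, hM⟩ := hJb
  have hae : ∀ᵐ w' ∂ν, w' ∈ Set.Icc 0 B := by
    rw [← prob_compl_eq_zero_iff measurableSet_Icc] at hν
    exact hν
  -- inner integral, extended continuously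
  let F : ℝ → ℝ := fun x => ∫ w', J (max 0 (min x sbar), w') ∂ν
  have hFc : Continuous F := by
    refine continuous_of_dominated (bound := fun _ => M) ?_ ?_ (integrable_const _) ?_
    · intro x
      exact (hJm.comp (by fun_prop)).aestronglyMeasurable
    · intro x
      exact Filter.Eventually.of_forall fun w' => hM _
    · filter_upwards [hae] with w' hw'
      refine hJc.comp_continuous (by fun_prop) ?_
      intro x
      exact ⟨⟨le_max_left _ _, max_le hsbar.le (min_le_right _ _)⟩, hw'⟩
  have hFb : ∀ x, ‖F x‖ ≤ M := by
    intro x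
    have := norm_integral_le_of_norm_le_const (μ := ν) (f := fun w' => J (max 0 (min x sbar), w'))
      (C := M) (Filter.Eventually.of_forall fun w' => hM _)
    simpa using this
  let G : ℝ → ℝ := fun y => ∫ t in Set.Ioi (0 : ℝ), Q * Real.exp (-(Q + θ) * t) * F (y + r * t)
  have hint : IntegrableOn (fun t => Q * Real.exp (-(Q + θ) * t) * M) (Set.Ioi (0 : ℝ)) :=
    ((exp_neg_integrableOn_Ioi 0 (by positivity : 0 < Q + θ)).const_mul Q).mul_const M
  have hGc : Continuous G := by
    refine continuous_of_dominated (bound := fun t => Q * Real.exp (-(Q + θ) * t) * M) ?_ ?_ hint ?_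
    · intro y
      exact Continuous.aestronglyMeasurable (by fun_prop)
    · intro y
      refine Filter.Eventually.of_forall fun t => ?_
      rw [norm_mul, Real.norm_of_nonneg (by positivity)]
      exact mul_le_mul_of_nonneg_left (hFb _) (by positivity)
    · exact Filter.Eventually.of_forall fun t => by fun_prop
  have hobj : ∀ s w u, u ≤ s → bellmanObj Q θ r sbar ν g J s w u = g (w - u) + G (s - u) := by
    intro s w u hu
    unfold bellmanObj
    congr 1
    refine setIntegral_congr_fun measurableSet_Ioi fun t ht => ?_
    have ht' : 0 < t := ht
    have h0 : 0 ≤ min (s - u + r * t) sbar :=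
      le_min (add_nonneg (sub_nonneg.2 hu) (by positivity)) hsbar.le
    simp only [F, max_eq_right h0]
  have himg : ∀ sw : ℝ × ℝ, sw ∈ Set.Icc 0 sbar ×ˢ Set.Icc 0 B →
      bellmanObj Q θ r sbar ν g J sw.1 sw.2 '' Set.Icc 0 (min sw.1 sw.2) =
      (fun v => g (sw.2 - v * min sw.1 sw.2) + G (sw.1 - v * min sw.1 sw.2)) '' Set.Icc 0 1 := by
    intro sw hsw
    have hm : 0 ≤ min sw.1 sw.2 := le_min hsw.1.1 hsw.2.1
    have hI : Set.Icc 0 (min sw.1 sw.2) = (fun v => v * min sw.1 sw.2) '' Set.Icc (0:ℝ) 1 := by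
      rw [Set.image_mul_right_Icc zero_le_one hm]; simp
    rw [hI, Set.image_image]
    refine Set.image_congr fun v hv => hobj _ _ _ ?_
    exact (mul_le_of_le_one_left hm hv.2).trans (min_le_left _ _)
  constructor
  · have hc : Continuous fun sw : ℝ × ℝ => sInf ((fun v =>
        g (sw.2 - v * min sw.1 sw.2) + G (sw.1 - v * min sw.1 sw.2)) '' Set.Icc (0:ℝ) 1) := by
      refine IsCompact.continuous_sInf
        (f := fun (sw : ℝ × ℝ) v => g (sw.2 - v * min sw.1 sw.2) + G (sw.1 - v * min sw.1 sw.2))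
        isCompact_Icc ?_
      fun_prop
    refine hc.continuousOn.congr fun sw hsw => ?_
    simp only [bellmanT, himg sw hsw]
  · intro sw hsw
    have hm : 0 ≤ min sw.1 sw.2 := le_min hsw.1.1 hsw.2.1
    obtain ⟨u, hu, h⟩ := IsCompact.exists_sInf_image_eq (isCompact_Icc (a := 0) (b := min sw.1 sw.2))
      (Set.nonempty_Icc.2 hm) (f := bellmanObj Q θ r sbar ν g J sw.1 sw.2) (by
        have : Continuous fun u => g (sw.2 - u) + G (sw.1 - u) := by fun_prop
        exact this.continuousOn.congr fun u hu => hobj _ _ _ (hu.2.trans (min_le_left _ _)))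
    exact ⟨u, hu, h⟩
end

section
/- The Bellman operator T preserves monotone decrease in the storage variable: if J : ℝ × ℝ → ℝ is bounded measurable and satisfies J(s₂, w) ≤ J(s₁, w) for all 0 ≤ s₁ ≤ s₂ ≤ s̄ and all w ∈ [0,B], then (TJ)(s₂, w) ≤ (TJ)(s₁, w) for all 0 ≤ s₁ ≤ s₂ ≤ s̄ and all w ∈ [0,B]. -/
open MeasureTheory

/-- The integrand is integrable on the half line. -/
theorem bellman_aux_integrable (Q θ r sbar : ℝ) (hQ : 0 < Q) (hθ : 0 < θ)
    (ν : Measure ℝ) [IsProbabilityMeasure ν]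
    (J : ℝ × ℝ → ℝ) (hJm : Measurable J) (M : ℝ) (hM : ∀ x, |J x| ≤ M) (c : ℝ) :
    IntegrableOn (fun t : ℝ => Q * Real.exp (-(Q + θ) * t) *
      (∫ w', J (min (c + r * t) sbar, w') ∂ν)) (Set.Ioi 0) := by
  have h1 : IntegrableOn (fun t : ℝ => Q * Real.exp (-(Q + θ) * t)) (Set.Ioi 0) :=
    (integrableOn_exp_mul_Ioi (by linarith) 0).const_mul Q
  refine Integrable.mul_bdd (c := M) h1 ?_ ?_
  · apply StronglyMeasurable.aestronglyMeasurable
    have h2 : StronglyMeasurable (fun p : ℝ × ℝ => J (min (c + r * p.1) sbar, p.2)) := by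
      apply Measurable.stronglyMeasurable
      exact hJm.comp (by fun_prop)
    exact h2.integral_prod_right'
  · refine Filter.Eventually.of_forall fun t => ?_
    have := norm_integral_le_of_norm_le_const (μ := ν)
      (f := fun w' => J (min (c + r * t) sbar, w')) (C := M)
      (Filter.Eventually.of_forall fun w' => by simpa using hM _)
    simpa using this

theorem bellman_preserves_antitone_in_storage
    (Q θ r sbar B : ℝ) (hQ : 0 < Q) (hθ : 0 < θ) (hr : 0 < r) (hsbar : 0 < sbar) (hB : 0 < B)
    (ν : Measure ℝ) [IsProbabilityMeasure ν] (hν : ν (Set.Icc 0 B) = 1)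
    (g : ℝ → ℝ) (hgm : Measurable g) (hgb : ∃ M, ∀ x, |g x| ≤ M)
    (J : ℝ × ℝ → ℝ) (hJm : Measurable J) (hJb : ∃ M, ∀ x, |J x| ≤ M)
    (hJmono : ∀ s₁ s₂ w : ℝ, 0 ≤ s₁ → s₁ ≤ s₂ → s₂ ≤ sbar → w ∈ Set.Icc 0 B →
      J (s₂, w) ≤ J (s₁, w)) :
    ∀ s₁ s₂ w : ℝ, 0 ≤ s₁ → s₁ ≤ s₂ → s₂ ≤ sbar → w ∈ Set.Icc 0 B →
      bellmanT Q θ r sbar ν g J (s₂, w) ≤ bellmanT Q θ r sbar ν g J (s₁, w) := by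
  intro s₁ s₂ w h0 h12 h2 hw
  obtain ⟨M, hM⟩ := hJb
  obtain ⟨G, hG⟩ := hgb
  have hae : ∀ᵐ x ∂ν, x ∈ Set.Icc 0 B :=
    (mem_ae_iff_prob_eq_one measurableSet_Icc).2 hν
  have hint : ∀ c : ℝ, Integrable (fun w' => J (c, w')) ν := fun c =>
    Integrable.of_bound (hJm.comp (by fun_prop)).aestronglyMeasurable M
      (Filter.Eventually.of_forall fun w' => by simpa using hM _)
  unfold bellmanT
  refine le_csInf ?_ ?_
  · exact ⟨_, 0, ⟨le_rfl, le_min h0 hw.1⟩, rfl⟩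
  · rintro _ ⟨u, ⟨hu0, hu⟩, rfl⟩
    have hus : u ≤ s₁ := hu.trans (min_le_left _ _)
    have huw : u ≤ w := hu.trans (min_le_right _ _)
    refine (csInf_le ?_ (Set.mem_image_of_mem _
      (show u ∈ Set.Icc 0 (min s₂ w) from ⟨hu0, le_min (hus.trans h12) huw⟩))).trans ?_
    · refine ⟨-G + ∫ t in Set.Ioi (0 : ℝ), Q * Real.exp (-(Q + θ) * t) * (-M), ?_⟩
      rintro _ ⟨v, -, rfl⟩
      unfold bellmanObj
      refine add_le_add (neg_le_of_abs_le (hG _)) ?_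
      refine setIntegral_mono_on ?_
        (bellman_aux_integrable Q θ r sbar hQ hθ ν J hJm M hM _) measurableSet_Ioi ?_
      · exact ((integrableOn_exp_mul_Ioi (by linarith) 0).const_mul Q).mul_const _
      · intro t _
        refine mul_le_mul_of_nonneg_left ?_ (by positivity)
        have := integral_mono (μ := ν) (integrable_const (-M))
          (hint (min (s₂ - v + r * t) sbar)) (fun w' => neg_le_of_abs_le (hM _))
        simpa using this
    · unfold bellmanObj
      refine add_le_add le_rfl ?_
      refine setIntegral_mono_on (bellman_aux_integrable Q θ r sbar hQ hθ ν J hJm M hM _)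
        (bellman_aux_integrable Q θ r sbar hQ hθ ν J hJm M hM _) measurableSet_Ioi ?_
      intro t ht
      refine mul_le_mul_of_nonneg_left ?_ (by positivity)
      refine integral_mono_ae (hint _) (hint _) ?_
      filter_upwards [hae] with x hx
      have hrt : 0 < r * t := mul_pos hr ht
      exact hJmono _ _ x (le_min (by linarith) hsbar.le)
        (min_le_min_right _ (by linarith)) (min_le_right _ _) hx
end

section
/- If the stage cost g is bounded and continuous, then the unique bounded continuous fixed point J* of the Bellman operator T is nonincreasing in the storage variable: J*(s₂, w) ≤ J*(s₁, w) for all 0 ≤ s₁ ≤ s₂ ≤ s̄ and all w ∈ [0,B]. -/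
open MeasureTheory

theorem aux_int_J (ν : Measure ℝ) [IsProbabilityMeasure ν] (J : ℝ × ℝ → ℝ) (hJm : Measurable J)
    (M : ℝ) (hM : ∀ x, |J x| ≤ M) (a : ℝ) : Integrable (fun w' => J (a, w')) ν := by
  refine Integrable.of_bound (C := M) ?_ ?_
  · exact (hJm.comp (measurable_const.prodMk measurable_id)).aestronglyMeasurable
  · exact Filter.Eventually.of_forall fun x => by simpa using hM (a, x)

theorem aux_int_k (Q θ : ℝ) (hQ : 0 < Q) (hθ : 0 < θ) :
    IntegrableOn (fun t => Q * Real.exp (-(Q + θ) * t)) (Set.Ioi (0 : ℝ)) :=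
  (integrableOn_exp_mul_Ioi (by linarith) 0).const_mul Q

theorem aux_int_F (Q θ r sbar : ℝ) (hQ : 0 < Q) (hθ : 0 < θ)
    (ν : Measure ℝ) [IsProbabilityMeasure ν] (J : ℝ × ℝ → ℝ) (hJm : Measurable J)
    (M : ℝ) (hM : ∀ x, |J x| ≤ M) (a : ℝ) :
    IntegrableOn (fun t => Q * Real.exp (-(Q + θ) * t) *
      (∫ w', J (min (a + r * t) sbar, w') ∂ν)) (Set.Ioi (0 : ℝ)) := by
  refine Integrable.mul_bdd (c := M) (aux_int_k Q θ hQ hθ) ?_ ?_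
  · have h : Measurable (fun p : ℝ × ℝ => J (min (a + r * p.1) sbar, p.2)) := by
      apply hJm.comp; fun_prop
    exact (h.stronglyMeasurable.integral_prod_right (ν := ν)).aestronglyMeasurable
  · refine Filter.Eventually.of_forall fun t => ?_
    have := norm_integral_le_of_norm_le_const (μ := ν) (C := M)
      (f := fun w' => J (min (a + r * t) sbar, w'))
      (Filter.Eventually.of_forall fun x => by simpa using hM _)
    simpa using this

theorem aux_step (Q θ r sbar B : ℝ) (hQ : 0 < Q) (hθ : 0 < θ) (hr : 0 < r) (hsbar : 0 < sbar)
    (ν : Measure ℝ) [IsProbabilityMeasure ν] (hν : ν (Set.Icc 0 B) = 1)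
    (g : ℝ → ℝ) (hgb : ∃ M, ∀ x, |g x| ≤ M)
    (J : ℝ × ℝ → ℝ) (hJm : Measurable J) (M : ℝ) (hM : ∀ x, |J x| ≤ M)
    (hfix : ∀ sw ∈ Set.Icc 0 sbar ×ˢ Set.Icc 0 B,
      bellmanT Q θ r sbar ν g J sw = J sw) (D : ℝ)
    (hD : ∀ s₁ s₂ w : ℝ, 0 ≤ s₁ → s₁ ≤ s₂ → s₂ ≤ sbar → w ∈ Set.Icc 0 B →
      J (s₂, w) ≤ J (s₁, w) + D) :
    ∀ s₁ s₂ w : ℝ, 0 ≤ s₁ → s₁ ≤ s₂ → s₂ ≤ sbar → w ∈ Set.Icc 0 B →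
      J (s₂, w) ≤ J (s₁, w) + Q / (Q + θ) * D := by
  intro s₁ s₂ w h0 h12 h2 hw
  obtain ⟨G, hG⟩ := hgb
  have hae : ∀ᵐ x ∂ν, x ∈ Set.Icc 0 B := (mem_ae_iff_prob_eq_one measurableSet_Icc).2 hν
  have hk : ∫ t in Set.Ioi (0 : ℝ), Q * Real.exp (-(Q + θ) * t) = Q / (Q + θ) := by
    rw [integral_const_mul, integral_exp_mul_Ioi (by linarith)]
    have : Q + θ ≠ 0 := by positivity
    simp only [mul_zero, Real.exp_zero]
    rw [neg_div_neg_eq, mul_one_div]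
  -- comparison of the objectives
  have hobj : ∀ u ∈ Set.Icc 0 (min s₁ w), bellmanObj Q θ r sbar ν g J s₂ w u ≤
      bellmanObj Q θ r sbar ν g J s₁ w u + Q / (Q + θ) * D := by
    intro u hu
    have hu1 : u ≤ s₁ := hu.2.trans (min_le_left _ _)
    unfold bellmanObj
    have key : ∫ t in Set.Ioi (0 : ℝ), Q * Real.exp (-(Q + θ) * t) *
          (∫ w', J (min (s₂ - u + r * t) sbar, w') ∂ν) ≤
        ∫ t in Set.Ioi (0 : ℝ), (Q * Real.exp (-(Q + θ) * t) *
          (∫ w', J (min (s₁ - u + r * t) sbar, w') ∂ν) + Q * Real.exp (-(Q + θ) * t) * D) := by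
      refine setIntegral_mono_on (aux_int_F Q θ r sbar hQ hθ ν J hJm M hM _)
        ((aux_int_F Q θ r sbar hQ hθ ν J hJm M hM _).add ((aux_int_k Q θ hQ hθ).mul_const D))
        measurableSet_Ioi ?_
      intro t ht
      have ht : 0 < t := ht
      rw [← mul_add]
      refine mul_le_mul_of_nonneg_left ?_ (by positivity)
      calc ∫ w', J (min (s₂ - u + r * t) sbar, w') ∂ν
          ≤ ∫ w', (J (min (s₁ - u + r * t) sbar, w') + D) ∂ν := by
            refine integral_mono_ae (aux_int_J ν J hJm M hM _)
              ((aux_int_J ν J hJm M hM _).add (integrable_const D)) ?_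
            filter_upwards [hae] with x hx
            have : 0 < r * t := by positivity
            refine hD _ _ x (le_min (by linarith) hsbar.le)
              (min_le_min_right _ (by linarith)) (min_le_right _ _) hx
        _ = _ := by
            rw [integral_add (aux_int_J ν J hJm M hM _) (integrable_const D)]
            simp
    rw [integral_add (aux_int_F Q θ r sbar hQ hθ ν J hJm M hM _)
      ((aux_int_k Q θ hQ hθ).mul_const D), integral_mul_const, hk] at key
    linarith
  have e1 := hfix (s₁, w) ⟨⟨h0, h12.trans h2⟩, hw⟩
  have e2 := hfix (s₂, w) ⟨⟨h0.trans h12, h2⟩, hw⟩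
  have hbdd : BddBelow (bellmanObj Q θ r sbar ν g J s₂ w '' Set.Icc 0 (min s₂ w)) := by
    refine ⟨-G - Q / (Q + θ) * M, ?_⟩
    rintro _ ⟨u, -, rfl⟩
    unfold bellmanObj
    have h1 := (abs_le.1 (hG (w - u))).1
    have h3 : ∫ t in Set.Ioi (0 : ℝ), Q * Real.exp (-(Q + θ) * t) * (-M) ≤
        ∫ t in Set.Ioi (0 : ℝ), Q * Real.exp (-(Q + θ) * t) *
          (∫ w', J (min (s₂ - u + r * t) sbar, w') ∂ν) := by
      refine setIntegral_mono_on ((aux_int_k Q θ hQ hθ).mul_const (-M))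
        (aux_int_F Q θ r sbar hQ hθ ν J hJm M hM _) measurableSet_Ioi ?_
      intro t ht
      refine mul_le_mul_of_nonneg_left ?_ (by positivity)
      have := integral_mono (integrable_const (-M))
        (aux_int_J ν J hJm M hM (min (s₂ - u + r * t) sbar)) (fun x => (abs_le.1 (hM _)).1)
      simpa using this
    rw [integral_mul_const, hk] at h3
    linarith
  have hmain : J (s₂, w) - Q / (Q + θ) * D ≤ J (s₁, w) := by
    rw [← e1]
    unfold bellmanT
    refine le_csInf (Set.Nonempty.image _ ⟨0, le_rfl, le_min h0 hw.1⟩) ?_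
    rintro _ ⟨u, hu, rfl⟩
    have h4 : J (s₂, w) ≤ bellmanObj Q θ r sbar ν g J s₂ w u := by
      rw [← e2]
      exact csInf_le hbdd ⟨u, ⟨hu.1, hu.2.trans (min_le_min_right _ h12)⟩, rfl⟩
    have := hobj u hu
    simp only at this ⊢
    linarith
  linarith

theorem fixed_point_antitone_in_storage
    (Q θ r sbar B : ℝ) (hQ : 0 < Q) (hθ : 0 < θ) (hr : 0 < r) (hsbar : 0 < sbar) (hB : 0 < B)
    (ν : Measure ℝ) [IsProbabilityMeasure ν] (hν : ν (Set.Icc 0 B) = 1)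
    (g : ℝ → ℝ) (hgm : Measurable g) (hgb : ∃ M, ∀ x, |g x| ≤ M) (hgc : Continuous g)
    (Jstar : ℝ × ℝ → ℝ) (hJm : Measurable Jstar) (hJb : ∃ M, ∀ x, |Jstar x| ≤ M)
    (hJc : ContinuousOn Jstar (Set.Icc 0 sbar ×ˢ Set.Icc 0 B))
    (hfix : ∀ sw ∈ Set.Icc 0 sbar ×ˢ Set.Icc 0 B,
      bellmanT Q θ r sbar ν g Jstar sw = Jstar sw) :
    ∀ s₁ s₂ w : ℝ, 0 ≤ s₁ → s₁ ≤ s₂ → s₂ ≤ sbar → w ∈ Set.Icc 0 B →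
      Jstar (s₂, w) ≤ Jstar (s₁, w) := by
  obtain ⟨M, hM⟩ := hJb
  have hit : ∀ n : ℕ, ∀ s₁ s₂ w : ℝ, 0 ≤ s₁ → s₁ ≤ s₂ → s₂ ≤ sbar → w ∈ Set.Icc 0 B →
      Jstar (s₂, w) ≤ Jstar (s₁, w) + (Q / (Q + θ)) ^ n * (2 * M) := by
    intro n
    induction n with
    | zero =>
      intro s₁ s₂ w _ _ _ _
      have h1 := abs_le.1 (hM (s₁, w))
      have h2 := abs_le.1 (hM (s₂, w))
      simp only [pow_zero, one_mul]
      linarith [h1.1, h2.2]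
    | succ n ih =>
      rw [pow_succ', mul_assoc]
      exact aux_step Q θ r sbar B hQ hθ hr hsbar ν hν g hgb Jstar hJm M hM hfix _ ih
  intro s₁ s₂ w h0 h12 h2 hw
  have hlim : Filter.Tendsto (fun n : ℕ => Jstar (s₁, w) + (Q / (Q + θ)) ^ n * (2 * M))
      Filter.atTop (nhds (Jstar (s₁, w) + 0 * (2 * M))) := by
    refine Filter.Tendsto.const_add _ (Filter.Tendsto.mul_const _ ?_)
    exact tendsto_pow_atTop_nhds_zero_of_lt_one (by positivity)
      ((div_lt_one (by positivity)).2 (by linarith))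
  have := ge_of_tendsto' hlim (fun n => hit n s₁ s₂ w h0 h12 h2 hw)
  simpa using this
end

section
/- For a linear stage cost g(x) = βx with β > 0, the Bellman operator T preserves the class K_β of functions that are nonincreasing and β-Lipschitz in the storage variable: if J : ℝ × ℝ → ℝ is bounded measurable and satisfies 0 ≤ J(s₁, w) − J(s₂, w) ≤ β(s₂ − s₁) for all 0 ≤ s₁ ≤ s₂ ≤ s̄ and all w ∈ [0,B], then TJ satisfies 0 ≤ (TJ)(s₁, w) − (TJ)(s₂, w) ≤ β(s₂ − s₁) for all 0 ≤ s₁ ≤ s₂ ≤ s̄ and all w ∈ [0,B]. -/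
open MeasureTheory

theorem bellman_aux_H
    (Q θ r sbar B β : ℝ) (hQ : 0 < Q) (hθ : 0 < θ) (hr : 0 < r) (hsbar : 0 < sbar)
    (hβ : 0 < β)
    (ν : Measure ℝ) [IsProbabilityMeasure ν] (hν : ν (Set.Icc 0 B) = 1)
    (J : ℝ × ℝ → ℝ) (hJm : Measurable J) (hJb : ∃ M, ∀ x, |J x| ≤ M)
    (hJK : ∀ s₁ s₂ w : ℝ, 0 ≤ s₁ → s₁ ≤ s₂ → s₂ ≤ sbar → w ∈ Set.Icc 0 B →
      0 ≤ J (s₁, w) - J (s₂, w) ∧ J (s₁, w) - J (s₂, w) ≤ β * (s₂ - s₁))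
    (x y : ℝ) (hx : 0 ≤ x) (hxy : x ≤ y) :
    (∫ t in Set.Ioi (0 : ℝ), Q * Real.exp (-(Q + θ) * t) *
      (∫ w', J (min (y + r * t) sbar, w') ∂ν)) ≤ (∫ t in Set.Ioi (0 : ℝ),
      Q * Real.exp (-(Q + θ) * t) * (∫ w', J (min (x + r * t) sbar, w') ∂ν)) ∧
    (∫ t in Set.Ioi (0 : ℝ), Q * Real.exp (-(Q + θ) * t) *
      (∫ w', J (min (x + r * t) sbar, w') ∂ν)) ≤ (∫ t in Set.Ioi (0 : ℝ),
      Q * Real.exp (-(Q + θ) * t) * (∫ w', J (min (y + r * t) sbar, w') ∂ν)) + β * (y - x) := by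
  obtain ⟨M, hM⟩ := hJb
  have hae : ∀ᵐ w' ∂ν, w' ∈ Set.Icc 0 B := by
    rw [← prob_compl_eq_zero_iff measurableSet_Icc] at hν
    exact measure_eq_zero_iff_ae_notMem.1 hν |>.mono fun w hw => by simpa using hw
  have hJi : ∀ z, Integrable (fun w' => J (z, w')) ν := fun z =>
    Integrable.of_bound (hJm.comp measurable_prodMk_left).aestronglyMeasurable M
      (Filter.Eventually.of_forall fun w' => hM _)
  have hGm : Measurable (fun z => ∫ w', J (z, w') ∂ν) :=
    (hJm.stronglyMeasurable.integral_prod_right' (ν := ν)).measurable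
  have hGb : ∀ z, ‖∫ w', J (z, w') ∂ν‖ ≤ M := fun z => by
    have := norm_integral_le_of_norm_le_const (μ := ν) (f := fun w' => J (z, w')) (C := M)
      (Filter.Eventually.of_forall fun w' => hM _)
    simpa using this
  have hG : ∀ a b, 0 ≤ a → a ≤ b → b ≤ sbar →
      (∫ w', J (b, w') ∂ν) ≤ (∫ w', J (a, w') ∂ν) ∧
      (∫ w', J (a, w') ∂ν) ≤ (∫ w', J (b, w') ∂ν) + β * (b - a) := by
    intro a b ha hab hb
    constructor
    · refine integral_mono_ae (hJi b) (hJi a) (hae.mono fun w hw => ?_)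
      have := hJK a b w ha hab hb hw
      simp only; linarith
    · have h : (∫ w', J (a, w') ∂ν) ≤ ∫ w', (J (b, w') + β * (b - a)) ∂ν := by
        refine integral_mono_ae (hJi a) ((hJi b).add (integrable_const _))
          (hae.mono fun w hw => ?_)
        have := hJK a b w ha hab hb hw
        simp only; linarith
      rw [integral_add (hJi b) (integrable_const _)] at h
      simpa using h
  have hc : 0 < Q + θ := by positivity
  have hEi : IntegrableOn (fun t : ℝ => Q * Real.exp (-(Q + θ) * t)) (Set.Ioi 0) :=
    (integrableOn_exp_mul_Ioi (by linarith) 0).const_mul Q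
  have hEv : ∫ t in Set.Ioi (0 : ℝ), Q * Real.exp (-(Q + θ) * t) = Q / (Q + θ) := by
    rw [integral_const_mul, integral_exp_mul_Ioi (by linarith) 0]
    simp only [mul_zero, Real.exp_zero]
    field_simp
  have hI : ∀ z : ℝ, IntegrableOn (fun t : ℝ => Q * Real.exp (-(Q + θ) * t) *
      (∫ w', J (min (z + r * t) sbar, w') ∂ν)) (Set.Ioi 0) := fun z => by
    refine Integrable.mul_bdd (c := M) hEi ?_ (Filter.Eventually.of_forall fun t => hGb _)
    exact (hGm.comp (by fun_prop : Measurable fun t : ℝ => min (z + r * t) sbar)).aestronglyMeasurable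
  have hpt : ∀ t ∈ Set.Ioi (0:ℝ), 0 ≤ min (x + r * t) sbar ∧
      min (x + r * t) sbar ≤ min (y + r * t) sbar ∧
      min (y + r * t) sbar - min (x + r * t) sbar ≤ y - x := by
    intro t ht
    have : 0 < r * t := mul_pos hr ht
    refine ⟨le_min (by linarith) hsbar.le, min_le_min_right _ (by linarith), ?_⟩
    rcases min_cases (x + r * t) sbar with h | h <;> rcases min_cases (y + r * t) sbar with h' | h' <;>
      linarith
  constructor
  · refine setIntegral_mono_on (hI y) (hI x) measurableSet_Ioi fun t ht => ?_
    obtain ⟨h1, h2, h3⟩ := hpt t ht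
    exact mul_le_mul_of_nonneg_left (hG _ _ h1 h2 (min_le_right _ _)).1 (by positivity)
  · have h : (∫ t in Set.Ioi (0 : ℝ), Q * Real.exp (-(Q + θ) * t) *
        (∫ w', J (min (x + r * t) sbar, w') ∂ν)) ≤ ∫ t in Set.Ioi (0 : ℝ),
        (Q * Real.exp (-(Q + θ) * t) * (∫ w', J (min (y + r * t) sbar, w') ∂ν) +
          Q * Real.exp (-(Q + θ) * t) * (β * (y - x))) := by
      refine setIntegral_mono_on (hI x) ((hI y).add (hEi.mul_const _)) measurableSet_Ioi
        fun t ht => ?_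
      obtain ⟨h1, h2, h3⟩ := hpt t ht
      rw [← mul_add]
      refine mul_le_mul_of_nonneg_left ?_ (by positivity)
      have := (hG _ _ h1 h2 (min_le_right _ _)).2
      have := mul_le_mul_of_nonneg_left h3 hβ.le
      linarith
    rw [integral_add (hI y) (hEi.mul_const _), integral_mul_const, hEv] at h
    have h4 : Q / (Q + θ) ≤ 1 := by rw [div_le_one hc]; linarith
    have h5 : 0 ≤ β * (y - x) := mul_nonneg hβ.le (by linarith)
    have := mul_le_mul_of_nonneg_right h4 h5
    linarith

theorem bellman_preserves_lipschitz_antitone_class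
    (Q θ r sbar B β : ℝ) (hQ : 0 < Q) (hθ : 0 < θ) (hr : 0 < r) (hsbar : 0 < sbar)
    (hB : 0 < B) (hβ : 0 < β)
    (ν : Measure ℝ) [IsProbabilityMeasure ν] (hν : ν (Set.Icc 0 B) = 1)
    (J : ℝ × ℝ → ℝ) (hJm : Measurable J) (hJb : ∃ M, ∀ x, |J x| ≤ M)
    (hJK : ∀ s₁ s₂ w : ℝ, 0 ≤ s₁ → s₁ ≤ s₂ → s₂ ≤ sbar → w ∈ Set.Icc 0 B →
      0 ≤ J (s₁, w) - J (s₂, w) ∧ J (s₁, w) - J (s₂, w) ≤ β * (s₂ - s₁)) :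
    ∀ s₁ s₂ w : ℝ, 0 ≤ s₁ → s₁ ≤ s₂ → s₂ ≤ sbar → w ∈ Set.Icc 0 B →
      0 ≤ bellmanT Q θ r sbar ν (fun x => β * x) J (s₁, w) -
            bellmanT Q θ r sbar ν (fun x => β * x) J (s₂, w) ∧
        bellmanT Q θ r sbar ν (fun x => β * x) J (s₁, w) -
            bellmanT Q θ r sbar ν (fun x => β * x) J (s₂, w) ≤ β * (s₂ - s₁) := by
  intro s₁ s₂ w hs1 hs12 hs2 hw
  have hH := bellman_aux_H Q θ r sbar B β hQ hθ hr hsbar hβ ν hν J hJm hJb hJK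
  obtain ⟨H, hHd⟩ : ∃ H : ℝ → ℝ, H = fun x => ∫ t in Set.Ioi (0 : ℝ),
    Q * Real.exp (-(Q + θ) * t) * (∫ w', J (min (x + r * t) sbar, w') ∂ν) := ⟨_, rfl⟩
  have hH' : ∀ x y, 0 ≤ x → x ≤ y → H y ≤ H x ∧ H x ≤ H y + β * (y - x) := by
    intro x y hx hxy
    rw [hHd]
    exact hH x y hx hxy
  have hobj : ∀ s u, bellmanObj Q θ r sbar ν (fun x => β * x) J s w u
      = β * (w - u) + H (s - u) := by
    intro s u
    rw [hHd]
    rfl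
  have hbdd : ∀ s, BddBelow (bellmanObj Q θ r sbar ν (fun x => β * x) J s w ''
      Set.Icc 0 (min s w)) := by
    intro s
    refine ⟨H s, ?_⟩
    rintro _ ⟨u, ⟨hu0, hu⟩, rfl⟩
    obtain ⟨hus, huw⟩ := le_min_iff.1 hu
    rw [hobj]
    have h1 := (hH' (s - u) s (by linarith) (by linarith)).1
    have h2 := mul_nonneg hβ.le (sub_nonneg.2 huw)
    linarith
  have hne : ∀ s, 0 ≤ s → (bellmanObj Q θ r sbar ν (fun x => β * x) J s w ''
      Set.Icc 0 (min s w)).Nonempty := fun s hs =>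
    (Set.nonempty_Icc.2 (le_min hs hw.1)).image _
  have hA : bellmanT Q θ r sbar ν (fun x => β * x) J (s₂, w) ≤
      bellmanT Q θ r sbar ν (fun x => β * x) J (s₁, w) := by
    refine le_csInf (hne s₁ hs1) ?_
    rintro _ ⟨u, ⟨hu0, hu⟩, rfl⟩
    obtain ⟨hus, huw⟩ := le_min_iff.1 hu
    simp only at hus huw
    refine (csInf_le (hbdd s₂) ⟨u, ⟨hu0, le_min (by linarith) huw⟩, rfl⟩).trans ?_
    simp only [hobj]
    have := (hH' (s₁ - u) (s₂ - u) (by linarith) (by linarith)).1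
    linarith
  have hC : bellmanT Q θ r sbar ν (fun x => β * x) J (s₁, w) - β * (s₂ - s₁) ≤
      bellmanT Q θ r sbar ν (fun x => β * x) J (s₂, w) := by
    refine le_csInf (hne s₂ (by linarith)) ?_
    rintro _ ⟨u, ⟨hu0, hu⟩, rfl⟩
    obtain ⟨hus, huw⟩ := le_min_iff.1 hu
    simp only at hus huw
    rw [sub_le_iff_le_add]
    rcases le_total (s₂ - s₁) u with h | h
    · refine (csInf_le (hbdd s₁) ⟨u - (s₂ - s₁), ⟨by linarith,
        le_min (by linarith) (by linarith)⟩, rfl⟩).trans ?_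
      simp only [hobj]
      rw [show s₁ - (u - (s₂ - s₁)) = s₂ - u by ring]
      linarith
    · refine (csInf_le (hbdd s₁) ⟨0, ⟨le_rfl, le_min hs1 hw.1⟩, rfl⟩).trans ?_
      simp only [hobj]
      have := (hH' s₁ (s₂ - u) hs1 (by linarith)).2
      rw [sub_zero, sub_zero]
      linarith
  exact ⟨by linarith, by linarith⟩
end

section
/- Myopic optimality under linear stage cost: let g(x) = βx with β > 0, and let J : ℝ × ℝ → ℝ be bounded measurable with 0 ≤ J(s₁, w) − J(s₂, w) ≤ β(s₂ − s₁) for all 0 ≤ s₁ ≤ s₂ ≤ s̄ and all w ∈ [0,B]. Then for every (s,w) ∈ [0,s̄] × [0,B], the function u ↦ β(w−u) + ∫_0^∞ Q e^{−(Q+θ)t} ( ∫ J(min{s−u+rt, s̄}, w') dν(w') ) dt is strictly decreasing on [0, min{s,w}]; consequently the myopic choice u = min{s,w} is the unique minimizer and attains the infimum defining (TJ)(s,w). -/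
open MeasureTheory

theorem myopic_unique_minimizer_linear_cost
    (Q θ r sbar B β : ℝ) (hQ : 0 < Q) (hθ : 0 < θ) (hr : 0 < r) (hsbar : 0 < sbar)
    (hB : 0 < B) (hβ : 0 < β)
    (ν : Measure ℝ) [IsProbabilityMeasure ν] (hν : ν (Set.Icc 0 B) = 1)
    (J : ℝ × ℝ → ℝ) (hJm : Measurable J) (hJb : ∃ M, ∀ x, |J x| ≤ M)
    (hJK : ∀ s₁ s₂ w : ℝ, 0 ≤ s₁ → s₁ ≤ s₂ → s₂ ≤ sbar → w ∈ Set.Icc 0 B →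
      0 ≤ J (s₁, w) - J (s₂, w) ∧ J (s₁, w) - J (s₂, w) ≤ β * (s₂ - s₁))
    (s w : ℝ) (hs : s ∈ Set.Icc 0 sbar) (hw : w ∈ Set.Icc 0 B) :
    StrictAntiOn (bellmanObj Q θ r sbar ν (fun x => β * x) J s w)
        (Set.Icc 0 (min s w)) ∧
      (∀ u ∈ Set.Icc 0 (min s w), u ≠ min s w →
        bellmanObj Q θ r sbar ν (fun x => β * x) J s w (min s w) <
          bellmanObj Q θ r sbar ν (fun x => β * x) J s w u) ∧
      bellmanT Q θ r sbar ν (fun x => β * x) J (s, w) =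
        bellmanObj Q θ r sbar ν (fun x => β * x) J s w (min s w) := by
  obtain ⟨M, hM⟩ := hJb
  have hc : -(Q + θ) < 0 := by linarith
  have hJi : ∀ x, Integrable (fun w' => J (x, w')) ν := fun x =>
    Integrable.of_bound (hJm.comp measurable_prodMk_left).aestronglyMeasurable M
      (Filter.Eventually.of_forall fun w' => by simpa using hM (x, w'))
  have hae : ∀ᵐ w' ∂ν, w' ∈ Set.Icc 0 B :=
    (mem_ae_iff_prob_eq_one measurableSet_Icc).2 hν
  have hhm : StronglyMeasurable (fun x => ∫ w', J (x, w') ∂ν) :=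
    StronglyMeasurable.integral_prod_right (f := fun x w' => J (x, w')) hJm.stronglyMeasurable
  have hhb : ∀ x, ‖∫ w', J (x, w') ∂ν‖ ≤ M := fun x => by
    have := norm_integral_le_of_norm_le_const (μ := ν) (f := fun w' => J (x, w')) (C := M)
      (Filter.Eventually.of_forall fun w' => by simpa using hM (x, w'))
    simpa using this
  have hexp : IntegrableOn (fun t => Q * Real.exp (-(Q + θ) * t)) (Set.Ioi 0) :=
    (integrableOn_exp_mul_Ioi hc 0).const_mul Q
  have hFi : ∀ u, IntegrableOn (fun t => Q * Real.exp (-(Q + θ) * t) *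
      (∫ w', J (min (s - u + r * t) sbar, w') ∂ν)) (Set.Ioi 0) := fun u => by
    refine Integrable.mul_bdd (c := M) hexp ?_ (Filter.Eventually.of_forall fun t => hhb _)
    exact (hhm.comp_measurable (g := fun t => min (s - u + r * t) sbar)
      (by fun_prop)).aestronglyMeasurable
  have hval : ∫ t in Set.Ioi (0:ℝ), Q * Real.exp (-(Q + θ) * t) = Q / (Q + θ) := by
    rw [integral_const_mul, integral_exp_mul_Ioi hc]
    simp only [mul_zero, Real.exp_zero]
    rw [neg_div_neg_eq]
    ring
  have hanti : StrictAntiOn (bellmanObj Q θ r sbar ν (fun x => β * x) J s w)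
      (Set.Icc 0 (min s w)) := by
    intro u₁ h₁ u₂ h₂ h12
    have hu2 : u₂ ≤ s := h₂.2.trans (min_le_left _ _)
    have hle : ∫ t in Set.Ioi (0 : ℝ), Q * Real.exp (-(Q + θ) * t) *
          (∫ w', J (min (s - u₂ + r * t) sbar, w') ∂ν) ≤
        ∫ t in Set.Ioi (0 : ℝ), (Q * Real.exp (-(Q + θ) * t) *
          (∫ w', J (min (s - u₁ + r * t) sbar, w') ∂ν) +
          Q * Real.exp (-(Q + θ) * t) * (β * (u₂ - u₁))) := by
      refine setIntegral_mono_on (hFi u₂) ((hFi u₁).add (hexp.mul_const _))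
        measurableSet_Ioi ?_
      intro t ht
      have ht : 0 < t := ht
      rw [← mul_add]
      refine mul_le_mul_of_nonneg_left ?_ (by positivity)
      have hrt : 0 < r * t := by positivity
      have key : ∫ w', J (min (s - u₂ + r * t) sbar, w') ∂ν ≤
          ∫ w', (J (min (s - u₁ + r * t) sbar, w') + β * (u₂ - u₁)) ∂ν := by
        refine integral_mono_ae (hJi _) ((hJi _).add (integrable_const _)) ?_
        filter_upwards [hae] with w' hw'
        have h := (hJK (min (s - u₂ + r * t) sbar) (min (s - u₁ + r * t) sbar) w'
          (le_min (by linarith) hsbar.le) (min_le_min_right _ (by linarith))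
          (min_le_right _ _) hw').2
        have h' : min (s - u₁ + r * t) sbar ≤ min (s - u₂ + r * t) sbar + (u₂ - u₁) := by
          rw [← min_add_add_right]
          exact min_le_min (by linarith) (by linarith)
        have := mul_le_mul_of_nonneg_left (sub_le_iff_le_add'.2 h') hβ.le
        linarith
      rw [integral_add (hJi _) (integrable_const _)] at key
      simpa using key
    rw [integral_add (hFi u₁) (hexp.mul_const _), integral_mul_const, hval] at hle
    have hlt : Q / (Q + θ) < 1 := (div_lt_one (by linarith)).2 (by linarith)
    have hpos : 0 < β * (u₂ - u₁) := mul_pos hβ (by linarith)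
    have := mul_lt_mul_of_pos_right hlt hpos
    unfold bellmanObj
    simp only
    linarith
  have hmem : min s w ∈ Set.Icc 0 (min s w) := ⟨le_min hs.1 hw.1, le_rfl⟩
  refine ⟨hanti, fun u hu hne => hanti hu hmem (lt_of_le_of_ne hu.2 hne), ?_⟩
  refine IsLeast.csInf_eq ⟨Set.mem_image_of_mem _ hmem, ?_⟩
  rintro _ ⟨u, hu, rfl⟩
  exact hanti.antitoneOn hu hmem hu.2
end

section
/- For a linear stage cost g(x) = βx with β > 0, the unique bounded continuous fixed point J* of the Bellman operator T satisfies 0 ≤ J*(s₁, w) − J*(s₂, w) ≤ β(s₂ − s₁) for all 0 ≤ s₁ ≤ s₂ ≤ s̄ and all w ∈ [0,B]; consequently, for every (s,w) ∈ [0,s̄] × [0,B], the myopic action u = min{s,w} attains the infimum in the fixed-point equation J*(s,w) = (TJ*)(s,w). -/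
open MeasureTheory

/-- Comparison of the discounted integrals of two bounded measurable functions. -/
theorem disc_compare (Q θ : ℝ) (hQ : 0 < Q) (hθ : 0 < θ) (f h : ℝ → ℝ) (M c : ℝ)
    (hf : Measurable f) (hh : Measurable h) (hfM : ∀ t, |f t| ≤ M) (hhM : ∀ t, |h t| ≤ M)
    (hfh : ∀ t, 0 < t → f t ≤ h t + c) :
    ∫ t in Set.Ioi (0 : ℝ), Q * Real.exp (-(Q + θ) * t) * f t ≤
      (∫ t in Set.Ioi (0 : ℝ), Q * Real.exp (-(Q + θ) * t) * h t) + Q / (Q + θ) * c := by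
  have hneg : -(Q + θ) < 0 := by linarith
  have hk : IntegrableOn (fun t => Q * Real.exp (-(Q + θ) * t)) (Set.Ioi 0) :=
    (integrableOn_exp_mul_Ioi hneg 0).const_mul Q
  have hkv : ∫ t in Set.Ioi (0 : ℝ), Q * Real.exp (-(Q + θ) * t) = Q / (Q + θ) := by
    rw [integral_const_mul, integral_exp_mul_Ioi hneg 0]
    have : Q + θ ≠ 0 := by positivity
    rw [mul_zero, Real.exp_zero, neg_div_neg_eq, mul_one_div]
  have hkf : IntegrableOn (fun t => Q * Real.exp (-(Q + θ) * t) * f t) (Set.Ioi 0) :=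
    Integrable.mul_bdd (c := M) hk hf.aestronglyMeasurable (Filter.Eventually.of_forall hfM)
  have hkh : IntegrableOn (fun t => Q * Real.exp (-(Q + θ) * t) * h t) (Set.Ioi 0) :=
    Integrable.mul_bdd (c := M) hk hh.aestronglyMeasurable (Filter.Eventually.of_forall hhM)
  have hkc : IntegrableOn (fun t => Q * Real.exp (-(Q + θ) * t) * c) (Set.Ioi 0) :=
    Integrable.mul_const hk c
  rw [← hkv, ← integral_mul_const, ← integral_add hkh hkc]
  refine setIntegral_mono_on hkf (hkh.add hkc) measurableSet_Ioi ?_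
  intro t ht
  have := mul_le_mul_of_nonneg_left (hfh t ht)
    (show 0 ≤ Q * Real.exp (-(Q + θ) * t) by positivity)
  linarith

/-- The almost-Lipschitz property with slack `ε`. -/
def SlackProp (sbar B β : ℝ) (J : ℝ × ℝ → ℝ) (ε : ℝ) : Prop :=
  ∀ s₁ s₂ w : ℝ, 0 ≤ s₁ → s₁ ≤ s₂ → s₂ ≤ sbar → w ∈ Set.Icc 0 B →
    J (s₂, w) ≤ J (s₁, w) + ε ∧ J (s₁, w) ≤ J (s₂, w) + (β * (s₂ - s₁) + ε)

/-- The continuation value. -/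
noncomputable def contV (Q θ r sbar : ℝ) (ν : Measure ℝ) (J : ℝ × ℝ → ℝ) (x : ℝ) : ℝ :=
  ∫ t in Set.Ioi (0 : ℝ), Q * Real.exp (-(Q + θ) * t) *
      (∫ w', J (min (x + r * t) sbar, w') ∂ν)

theorem int_compare (B : ℝ) (ν : Measure ℝ) [IsProbabilityMeasure ν]
    (hν : ν (Set.Icc 0 B) = 1) (f h : ℝ → ℝ) (M c : ℝ)
    (hf : Measurable f) (hh : Measurable h) (hfM : ∀ t, |f t| ≤ M) (hhM : ∀ t, |h t| ≤ M)
    (hfh : ∀ t ∈ Set.Icc 0 B, f t ≤ h t + c) : ∫ w, f w ∂ν ≤ (∫ w, h w ∂ν) + c := by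
  have hfi : Integrable f ν := Integrable.of_bound hf.aestronglyMeasurable M
    (Filter.Eventually.of_forall hfM)
  have hhi : Integrable h ν := Integrable.of_bound hh.aestronglyMeasurable M
    (Filter.Eventually.of_forall hhM)
  have hae : ∀ᵐ w ∂ν, w ∈ Set.Icc 0 B := (mem_ae_iff_prob_eq_one measurableSet_Icc).2 hν
  have : ∫ w, f w ∂ν ≤ ∫ w, (h w + c) ∂ν := by
    refine integral_mono_ae hfi (hhi.add (integrable_const c)) ?_
    filter_upwards [hae] with w hw using hfh w hw
  rw [integral_add hhi (integrable_const c)] at this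
  simpa using this

theorem contV_slack (Q θ r sbar B β : ℝ) (hQ : 0 < Q) (hθ : 0 < θ) (hr : 0 < r)
    (hsbar : 0 < sbar) (hβ : 0 < β)
    (ν : Measure ℝ) [IsProbabilityMeasure ν] (hν : ν (Set.Icc 0 B) = 1)
    (J : ℝ × ℝ → ℝ) (hJm : Measurable J) (M : ℝ) (hM : ∀ x, |J x| ≤ M) (ε : ℝ)
    (hP : SlackProp sbar B β J ε) (x₁ x₂ : ℝ) (h0 : 0 ≤ x₁) (h12 : x₁ ≤ x₂) :
    contV Q θ r sbar ν J x₂ ≤ contV Q θ r sbar ν J x₁ + Q / (Q + θ) * ε ∧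
    contV Q θ r sbar ν J x₁ ≤
      contV Q θ r sbar ν J x₂ + Q / (Q + θ) * (β * (x₂ - x₁) + ε) := by
  have hKm : Measurable (fun a => ∫ w', J (a, w') ∂ν) :=
    (hJm.stronglyMeasurable.integral_prod_right' (ν := ν)).measurable
  have hKM : ∀ a, |∫ w', J (a, w') ∂ν| ≤ M := by
    intro a
    have := norm_integral_le_of_norm_le_const (μ := ν) (f := fun w' => J (a, w')) (C := M)
      (Filter.Eventually.of_forall fun w => hM (a, w))
    simpa using this
  have hm : ∀ x, Measurable (fun t => ∫ w', J (min (x + r * t) sbar, w') ∂ν) := by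
    intro x
    exact hKm.comp (by fun_prop : Measurable fun t : ℝ => min (x + r * t) sbar)
  have hJa : ∀ a, Measurable fun w => J (a, w) := fun a => hJm.comp (by fun_prop)
  have key : ∀ t, 0 < t → 0 ≤ min (x₁ + r * t) sbar ∧
      min (x₁ + r * t) sbar ≤ min (x₂ + r * t) sbar ∧ min (x₂ + r * t) sbar ≤ sbar ∧
      min (x₂ + r * t) sbar - min (x₁ + r * t) sbar ≤ x₂ - x₁ := by
    intro t ht
    have hrt : 0 < r * t := by positivity
    refine ⟨le_min (by linarith) hsbar.le, min_le_min_right _ (by linarith), min_le_right _ _, ?_⟩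
    rcases min_cases (x₁ + r * t) sbar with h | h <;>
      rcases min_cases (x₂ + r * t) sbar with h' | h' <;> linarith
  constructor
  · refine disc_compare Q θ hQ hθ _ _ M ε (hm _) (hm _) (fun _ => hKM _) (fun _ => hKM _) ?_
    intro t ht
    obtain ⟨k1, k2, k3, k4⟩ := key t ht
    exact int_compare B ν hν _ _ M ε (hJa _) (hJa _) (fun _ => hM _) (fun _ => hM _)
      fun w hw => (hP _ _ w k1 k2 k3 hw).1
  · refine disc_compare Q θ hQ hθ _ _ M _ (hm _) (hm _) (fun _ => hKM _) (fun _ => hKM _) ?_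
    intro t ht
    obtain ⟨k1, k2, k3, k4⟩ := key t ht
    refine int_compare B ν hν _ _ M _ (hJa _) (hJa _) (fun _ => hM _) (fun _ => hM _)
      fun w hw => (hP _ _ w k1 k2 k3 hw).2.trans ?_
    have := mul_le_mul_of_nonneg_left k4 hβ.le
    linarith

theorem fixed_point_linear_cost_myopic_optimal
    (Q θ r sbar B β : ℝ) (hQ : 0 < Q) (hθ : 0 < θ) (hr : 0 < r) (hsbar : 0 < sbar)
    (hB : 0 < B) (hβ : 0 < β)
    (ν : Measure ℝ) [IsProbabilityMeasure ν] (hν : ν (Set.Icc 0 B) = 1)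
    (Jstar : ℝ × ℝ → ℝ) (hJm : Measurable Jstar) (hJb : ∃ M, ∀ x, |Jstar x| ≤ M)
    (hJc : ContinuousOn Jstar (Set.Icc 0 sbar ×ˢ Set.Icc 0 B))
    (hfix : ∀ sw ∈ Set.Icc 0 sbar ×ˢ Set.Icc 0 B,
      bellmanT Q θ r sbar ν (fun x => β * x) Jstar sw = Jstar sw) :
    (∀ s₁ s₂ w : ℝ, 0 ≤ s₁ → s₁ ≤ s₂ → s₂ ≤ sbar → w ∈ Set.Icc 0 B →
      0 ≤ Jstar (s₁, w) - Jstar (s₂, w) ∧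
        Jstar (s₁, w) - Jstar (s₂, w) ≤ β * (s₂ - s₁)) ∧
    ∀ s w : ℝ, s ∈ Set.Icc 0 sbar → w ∈ Set.Icc 0 B →
      Jstar (s, w) = bellmanObj Q θ r sbar ν (fun x => β * x) Jstar s w (min s w) := by
  obtain ⟨M, hM⟩ := hJb
  have hM0 : 0 ≤ M := (abs_nonneg _).trans (hM (0, 0))
  set V := contV Q θ r sbar ν Jstar with hV
  have hobj : ∀ s w u, bellmanObj Q θ r sbar ν (fun x => β * x) Jstar s w u =
      β * (w - u) + V (s - u) := fun s w u => rfl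
  have hγ0 : 0 ≤ Q / (Q + θ) := by positivity
  have hγ1 : Q / (Q + θ) < 1 := by rw [div_lt_one (by positivity)]; linarith
  have hslack := contV_slack Q θ r sbar B β hQ hθ hr hsbar hβ ν hν Jstar hJm M hM
  rw [← hV] at hslack
  -- lower bound of the continuation value
  have hVlow : ∃ C, ∀ x, 0 ≤ x → C ≤ V x := by
    have h2 : SlackProp sbar B β Jstar (2 * M) := by
      intro s₁ s₂ w _ h12 _ _
      have a := abs_le.1 (hM (s₁, w))
      have b := abs_le.1 (hM (s₂, w))
      have : 0 ≤ β * (s₂ - s₁) := mul_nonneg hβ.le (by linarith)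
      constructor <;> linarith [a.1, a.2, b.1, b.2]
    refine ⟨V 0 - Q / (Q + θ) * (β * sbar + 2 * M) - Q / (Q + θ) * (2 * M), fun x hx => ?_⟩
    rcases le_total x sbar with h | h
    · have h3 := (hslack _ h2 0 x le_rfl hx).2
      have h4 : Q / (Q + θ) * (β * (x - 0) + 2 * M) ≤ Q / (Q + θ) * (β * sbar + 2 * M) := by
        gcongr; linarith
      have h5 : 0 ≤ Q / (Q + θ) * (2 * M) := by positivity
      linarith
    · have hVx : V x = V sbar := by
        simp only [hV, contV]
        refine setIntegral_congr_fun measurableSet_Ioi fun t ht => ?_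
        have : 0 < r * t := mul_pos hr ht
        rw [min_eq_right (by linarith), min_eq_right (by linarith)]
      have h3 := (hslack _ h2 0 sbar le_rfl hsbar.le).2
      have h5 : 0 ≤ Q / (Q + θ) * (2 * M) := by positivity
      rw [hVx]
      simp only [sub_zero] at h3
      linarith
  obtain ⟨C, hC⟩ := hVlow
  have hle : ∀ s w u, s ∈ Set.Icc 0 sbar → w ∈ Set.Icc 0 B → 0 ≤ u → u ≤ min s w →
      Jstar (s, w) ≤ β * (w - u) + V (s - u) := by
    intro s w u hs hw hu hu'
    rw [← hfix (s, w) ⟨hs, hw⟩, ← hobj]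
    refine csInf_le ⟨C, ?_⟩ ⟨u, ⟨hu, hu'⟩, rfl⟩
    rintro _ ⟨v, ⟨hv0, hv1⟩, rfl⟩
    simp only [hobj]
    have h1 := hv1.trans (min_le_left _ _)
    have h2 := hv1.trans (min_le_right _ _)
    simp only at h1 h2
    have h3 := hC (s - v) (by linarith)
    have h4 : 0 ≤ β * (w - v) := mul_nonneg hβ.le (by linarith)
    linarith
  have hge : ∀ s w c, s ∈ Set.Icc 0 sbar → w ∈ Set.Icc 0 B →
      (∀ u, 0 ≤ u → u ≤ s → u ≤ w → c ≤ β * (w - u) + V (s - u)) → c ≤ Jstar (s, w) := by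
    intro s w c hs hw h
    rw [← hfix (s, w) ⟨hs, hw⟩]
    refine le_csInf ((Set.nonempty_Icc.2 (le_min hs.1 hw.1)).image _) ?_
    rintro _ ⟨v, ⟨hv0, hv1⟩, rfl⟩
    simp only [hobj]
    exact h v hv0 (hv1.trans (min_le_left _ _)) (hv1.trans (min_le_right _ _))
  have hstep : ∀ ε, SlackProp sbar B β Jstar ε →
      SlackProp sbar B β Jstar (Q / (Q + θ) * ε) := by
    intro ε hε s₁ s₂ w h0 h12 h2 hw
    have hs1 : s₁ ∈ Set.Icc 0 sbar := ⟨h0, h12.trans h2⟩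
    have hs2 : s₂ ∈ Set.Icc 0 sbar := ⟨h0.trans h12, h2⟩
    constructor
    · rw [← sub_le_iff_le_add]
      refine hge s₁ w _ hs1 hw fun u hu hus huw => ?_
      have a := hle s₂ w u hs2 hw hu (le_min (hus.trans h12) huw)
      have b := (hslack ε hε (s₁ - u) (s₂ - u) (by linarith) (by linarith)).1
      linarith
    · rw [← sub_le_iff_le_add]
      refine hge s₂ w _ hs2 hw fun u hu hus huw => ?_
      have contr : ∀ d, 0 ≤ d → Q / (Q + θ) * (β * d + ε) ≤ β * d + Q / (Q + θ) * ε := by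
        intro d hd
        have : Q / (Q + θ) * (β * d) ≤ 1 * (β * d) :=
          mul_le_mul_of_nonneg_right hγ1.le (by positivity)
        linarith
      rcases le_total u s₁ with h | h
      · have a := hle s₁ w u hs1 hw hu (le_min h huw)
        have b := (hslack ε hε (s₁ - u) (s₂ - u) (by linarith) (by linarith)).2
        have c := contr (s₂ - u - (s₁ - u)) (by linarith)
        linarith
      · have a := hle s₁ w s₁ hs1 hw h0 (le_min le_rfl (h.trans huw))
        have b := (hslack ε hε (s₁ - s₁) (s₂ - u) (by linarith) (by linarith)).2
        have c := contr (s₂ - u - (s₁ - s₁)) (by linarith)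
        linarith
  have hiter : ∀ n : ℕ, SlackProp sbar B β Jstar ((Q / (Q + θ)) ^ n * (2 * M)) := by
    intro n
    induction n with
    | zero =>
      intro s₁ s₂ w _ h12 _ _
      have a := abs_le.1 (hM (s₁, w))
      have b := abs_le.1 (hM (s₂, w))
      have : 0 ≤ β * (s₂ - s₁) := mul_nonneg hβ.le (by linarith)
      constructor <;> linarith [a.1, a.2, b.1, b.2]
    | succ n ih =>
      have := hstep _ ih
      rwa [← mul_assoc, ← pow_succ'] at this
  have hlim : Filter.Tendsto (fun n : ℕ => (Q / (Q + θ)) ^ n * (2 * M)) Filter.atTop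
      (nhds 0) := by
    simpa using (tendsto_pow_atTop_nhds_zero_of_lt_one hγ0 hγ1).mul_const (2 * M)
  have hzero : SlackProp sbar B β Jstar 0 := by
    intro s₁ s₂ w h0 h12 h2 hw
    constructor
    · exact ge_of_tendsto' (hlim.const_add _) fun n => (hiter n s₁ s₂ w h0 h12 h2 hw).1
    · exact ge_of_tendsto' ((hlim.const_add _).const_add _)
        fun n => (hiter n s₁ s₂ w h0 h12 h2 hw).2
  refine ⟨fun s₁ s₂ w h0 h12 h2 hw => ?_, fun s w hs hw => ?_⟩
  · have := hzero s₁ s₂ w h0 h12 h2 hw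
    constructor <;> linarith [this.1, this.2]
  · rw [hobj]
    apply le_antisymm
    · exact hle s w _ hs hw (le_min hs.1 hw.1) le_rfl
    · refine hge s w _ hs hw fun u hu hus huw => ?_
      have hm := le_min hus huw
      have hms := min_le_left s w
      have b := (hslack 0 hzero (s - min s w) (s - u) (by linarith) (by linarith)).2
      have c : Q / (Q + θ) * (β * (s - u - (s - min s w)) + 0) ≤
          1 * (β * (s - u - (s - min s w)) + 0) :=
        mul_le_mul_of_nonneg_right hγ1.le
          (by have := mul_nonneg hβ.le (show 0 ≤ s - u - (s - min s w) by linarith); linarith)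
      linarith
end

section
/- Policy collapse to a one-dimensional kernel: let g : ℝ → ℝ be strictly convex and continuous and let C : ℝ → ℝ be convex and continuous on [0,s̄]. Then for every (s,w) ∈ [0,s̄] × [0,B], the point u* = max{0, w − φ(s−w)} is the unique minimizer of u ↦ g(w−u) + C(s−u) over the interval [0, min{s,w}]. -/
/-- The feasible interval `I(p) = [max{0, −p}, min{B, s̄ − p}]`. -/
def feasI (B sbar p : ℝ) : Set ℝ := Set.Icc (max 0 (-p)) (min B (sbar - p))

theorem policy_collapse_to_kernel
    (B sbar : ℝ) (hB : 0 < B) (hsbar : 0 < sbar)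
    (g C : ℝ → ℝ) (hg : StrictConvexOn ℝ Set.univ g) (hgc : Continuous g)
    (hC : ConvexOn ℝ (Set.Icc 0 sbar) C) (hCc : ContinuousOn C (Set.Icc 0 sbar))
    (φ : ℝ → ℝ)
    (hφ : ∀ p ∈ Set.Icc (-B) sbar, φ p ∈ feasI B sbar p ∧
      ∀ x ∈ feasI B sbar p, g (φ p) + C (φ p + p) ≤ g x + C (x + p))
    (s w : ℝ) (hs : s ∈ Set.Icc 0 sbar) (hw : w ∈ Set.Icc 0 B) :
    max 0 (w - φ (s - w)) ∈ Set.Icc 0 (min s w) ∧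
    (∀ u ∈ Set.Icc 0 (min s w),
      g (w - max 0 (w - φ (s - w))) + C (s - max 0 (w - φ (s - w))) ≤
        g (w - u) + C (s - u)) ∧
    (∀ u ∈ Set.Icc 0 (min s w),
      g (w - u) + C (s - u) =
          g (w - max 0 (w - φ (s - w))) + C (s - max 0 (w - φ (s - w))) →
        u = max 0 (w - φ (s - w))) := by
  obtain ⟨hs0, hs1⟩ := hs
  obtain ⟨hw0, hw1⟩ := hw
  obtain ⟨p, hp⟩ : ∃ p, p = s - w := ⟨_, rfl⟩
  rw [← hp]
  obtain ⟨hmem, hmin⟩ := hφ p ⟨by linarith, by linarith⟩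
  have hI : ∀ x, x ∈ feasI B sbar p ↔ (0 ≤ x ∧ -p ≤ x) ∧ (x ≤ B ∧ x ≤ sbar - p) := by
    intro x
    simp only [feasI, Set.mem_Icc, max_le_iff, le_min_iff]
  have hF : StrictConvexOn ℝ (feasI B sbar p) (fun x => g x + C (x + p)) := by
    refine ⟨convex_Icc _ _, ?_⟩
    intro x hx y hy hxy a b ha hb hab
    have h1 := hg.2 (Set.mem_univ x) (Set.mem_univ y) hxy ha hb hab
    rw [hI] at hx hy
    have h2 := hC.2 (x := x + p) ⟨by linarith, by linarith⟩ (y := y + p)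
      ⟨by linarith, by linarith⟩ ha.le hb.le hab
    have e : a • (x + p) + b • (y + p) = a • x + b • y + p := by
      simp only [smul_eq_mul]
      linear_combination p * hab
    rw [e] at h2
    simp only [smul_eq_mul] at *
    linarith
  obtain ⟨f, hf⟩ : ∃ f, f = φ p := ⟨_, rfl⟩
  rw [← hf] at hmem hmin ⊢
  have hm := (hI f).1 hmem
  have hxI : ∀ u ∈ Set.Icc 0 (min s w), w - u ∈ feasI B sbar p := by
    intro u hu
    rw [Set.mem_Icc, le_min_iff] at hu
    rw [hI]
    refine ⟨⟨?_, ?_⟩, ?_, ?_⟩ <;> linarith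
  have hm1 : max 0 (w - f) ∈ Set.Icc 0 (min s w) := by
    rw [Set.mem_Icc, le_min_iff]
    refine ⟨le_max_left _ _, max_le hs0 ?_, max_le hw0 ?_⟩ <;> linarith
  have key : ∀ u ∈ Set.Icc 0 (min s w), u ≠ max 0 (w - f) →
      g (w - max 0 (w - f)) + C (s - max 0 (w - f)) < g (w - u) + C (s - u) := by
    intro u hu hne
    have hx := hxI u hu
    have es : ∀ v, s - v = w - v + p := by intro v; rw [hp]; ring
    rw [es u, es (max 0 (w - f))]
    have hle := hmin _ hx
    rcases le_total f w with h | h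
    · rw [max_eq_right (by linarith)] at hne ⊢
      have e : w - (w - f) = f := by ring
      rw [e]
      refine lt_of_le_of_ne hle ?_
      intro heq
      have hd : f ≠ w - u := by
        intro h'
        apply hne
        linarith
      have h3 := hF.2 hmem hx hd (by norm_num : (0:ℝ) < 1/2) (by norm_num : (0:ℝ) < 1/2) (by norm_num)
      have h4 := hmin _ (hF.1 hmem hx (by norm_num : (0:ℝ) ≤ 1/2) (by norm_num : (0:ℝ) ≤ 1/2)
        (by norm_num))
      simp only [smul_eq_mul] at h3 h4
      linarith
    · rw [max_eq_left (by linarith)] at hne ⊢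
      have hu0 : 0 < u := lt_of_le_of_ne hu.1 (Ne.symm hne)
      rcases h.eq_or_lt with h | h
      · subst h
        have hd : w ≠ w - u := by
          intro h'
          linarith
        rw [sub_zero]
        refine lt_of_le_of_ne hle ?_
        intro heq
        have h3 := hF.2 hmem hx hd (by norm_num : (0:ℝ) < 1/2) (by norm_num : (0:ℝ) < 1/2) (by norm_num)
        have h4 := hmin _ (hF.1 hmem hx (by norm_num : (0:ℝ) ≤ 1/2) (by norm_num : (0:ℝ) ≤ 1/2)
          (by norm_num))
        simp only [smul_eq_mul] at h3 h4
        linarith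
      · have h5 := hF.lt_on_openSegment hx hmem (by linarith : w - u < f).ne
          (z := w) (by
            rw [openSegment_eq_Ioo (by linarith : w - u < f)]
            exact ⟨by linarith, h⟩)
        rw [sub_zero]
        rwa [max_eq_left hle] at h5
  refine ⟨hm1, ?_, ?_⟩
  · intro u hu
    by_cases h : u = max 0 (w - f)
    · rw [← h]
    · exact (key u hu h).le
  · intro u hu heq
    by_contra h
    exact absurd heq (key u hu h).ne'
end

section
/- Stickiness of the lower boundary of the kernel: let g, C : ℝ → ℝ be differentiable with g convex on [0,B] and C convex on [0,s̄], and let p₀ ∈ [−B, 0]. If x = −p₀ minimizes x ↦ g(x) + C(x+p₀) over I(p₀), i.e. g(−p₀) + C(0) ≤ g(x) + C(x+p₀) for all x ∈ I(p₀), then for every p ∈ [−B, p₀], x = −p minimizes x ↦ g(x) + C(x+p) over I(p), i.e. g(−p) + C(0) ≤ g(x) + C(x+p) for all x ∈ I(p). -/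
theorem kernel_lower_boundary_sticky
    (B sbar : ℝ) (hB : 0 < B) (hsbar : 0 < sbar)
    (g C : ℝ → ℝ) (hgd : Differentiable ℝ g) (hCd : Differentiable ℝ C)
    (hg : ConvexOn ℝ (Set.Icc 0 B) g) (hC : ConvexOn ℝ (Set.Icc 0 sbar) C)
    (p₀ : ℝ) (hp₀ : p₀ ∈ Set.Icc (-B) 0)
    (hmin : ∀ x ∈ feasI B sbar p₀, g (-p₀) + C 0 ≤ g x + C (x + p₀)) :
    ∀ p ∈ Set.Icc (-B) p₀, ∀ x ∈ feasI B sbar p, g (-p) + C 0 ≤ g x + C (x + p) := by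
  intro p hp x hx
  simp only [feasI, Set.mem_Icc, max_le_iff, le_min_iff] at hmin hx hp hp₀
  obtain ⟨hp1, hp2⟩ := hp
  obtain ⟨⟨hx0, hx1⟩, hx2, hx3⟩ := hx
  obtain ⟨hq1, hq2⟩ := hp₀
  have h := hmin (x + p - p₀) ⟨⟨by linarith, by linarith⟩, by linarith, by linarith⟩
  have e : x + p - p₀ + p₀ = x + p := by ring
  rw [e] at h
  have key : g (-p) + g (x + p - p₀) ≤ g (-p₀) + g x := by
    rcases eq_or_lt_of_le (show (0:ℝ) ≤ x + p₀ by linarith) with h0 | h0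
    · have e1 : x = -p₀ := by linarith
      have e2 : p = p₀ := by linarith
      subst e1 e2
      simp
    · have ha : -p₀ ∈ Set.Icc 0 B := ⟨by linarith, by linarith⟩
      have hb : x ∈ Set.Icc 0 B := ⟨hx0, hx2⟩
      have u0 : 0 ≤ (x + p) / (x + p₀) := div_nonneg (by linarith) h0.le
      have v0 : 0 ≤ (p₀ - p) / (x + p₀) := div_nonneg (by linarith) h0.le
      have uv : (x + p) / (x + p₀) + (p₀ - p) / (x + p₀) = 1 := by
        field_simp
        ring
      have k1 := hg.2 ha hb u0 v0 uv
      have k2 := hg.2 ha hb v0 u0 (by linarith)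
      simp only [smul_eq_mul] at k1 k2
      have e1 : (x + p) / (x + p₀) * -p₀ + (p₀ - p) / (x + p₀) * x = -p := by
        field_simp
        ring
      have e2 : (p₀ - p) / (x + p₀) * -p₀ + (x + p) / (x + p₀) * x = x + p - p₀ := by
        field_simp
        ring
      rw [e1] at k1
      rw [e2] at k2
      have k3 : ((x + p) / (x + p₀) + (p₀ - p) / (x + p₀)) * (g (-p₀) + g x)
          = g (-p₀) + g x := by rw [uv, one_mul]
      linarith
  linarith
end

section
/- Stickiness of zero for the kernel: let g, C : ℝ → ℝ be differentiable with g convex on [0,B] and C convex on [0,s̄], and let p₁ ∈ [0, s̄]. If x = 0 minimizes x ↦ g(x) + C(x+p₁) over I(p₁), i.e. g(0) + C(p₁) ≤ g(x) + C(x+p₁) for all x ∈ I(p₁), then for every p ∈ [p₁, s̄], x = 0 minimizes x ↦ g(x) + C(x+p) over I(p), i.e. g(0) + C(p) ≤ g(x) + C(x+p) for all x ∈ I(p). -/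
theorem kernel_zero_sticky
    (B sbar : ℝ) (hB : 0 < B) (hsbar : 0 < sbar)
    (g C : ℝ → ℝ) (hgd : Differentiable ℝ g) (hCd : Differentiable ℝ C)
    (hg : ConvexOn ℝ (Set.Icc 0 B) g) (hC : ConvexOn ℝ (Set.Icc 0 sbar) C)
    (p₁ : ℝ) (hp₁ : p₁ ∈ Set.Icc 0 sbar)
    (hmin : ∀ x ∈ feasI B sbar p₁, g 0 + C p₁ ≤ g x + C (x + p₁)) :
    ∀ p ∈ Set.Icc p₁ sbar, ∀ x ∈ feasI B sbar p, g 0 + C p ≤ g x + C (x + p) := by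
  intro p hp x hx
  simp only [feasI, Set.mem_Icc, max_le_iff, le_min_iff] at hmin hx hp hp₁
  obtain ⟨⟨hx0, hx1⟩, hxB, hxs⟩ := hx
  obtain ⟨hp1, hps⟩ := hp
  have h1 := hmin x ⟨⟨hx0, by linarith⟩, hxB, by linarith⟩
  suffices h : C p + C (x + p₁) ≤ C p₁ + C (x + p) by linarith
  rcases eq_or_lt_of_le (show 0 ≤ x + (p - p₁) by linarith) with h0 | hL
  · have e1 : x = 0 := by linarith
    have e2 : p = p₁ := by linarith
    subst e1 e2
    simp
  · have ma : p₁ ∈ Set.Icc 0 sbar := ⟨by linarith, by linarith⟩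
    have mb : x + p ∈ Set.Icc 0 sbar := ⟨by linarith, by linarith⟩
    have u : 0 ≤ x / (x + (p - p₁)) := div_nonneg hx0 hL.le
    have v : 0 ≤ (p - p₁) / (x + (p - p₁)) := div_nonneg (by linarith) hL.le
    have uv : x / (x + (p - p₁)) + (p - p₁) / (x + (p - p₁)) = 1 := by
      rw [← add_div, div_self hL.ne']
    have hu : x / (x + (p - p₁)) * (x + (p - p₁)) = x := div_mul_cancel₀ _ hL.ne'
    generalize x / (x + (p - p₁)) = a at *
    generalize (p - p₁) / (x + (p - p₁)) = b at *
    obtain rfl : b = 1 - a := by linarith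
    have k1 := hC.2 ma mb u v (by ring)
    have k2 := hC.2 ma mb v u (by ring)
    simp only [smul_eq_mul] at k1 k2
    rw [show a * p₁ + (1 - a) * (x + p) = p by linarith] at k1
    rw [show (1 - a) * p₁ + a * (x + p) = x + p₁ by linarith] at k2
    linarith
end

section
/- Inactivity of the upper constraint under positive drift: assume Q·∫ w dν ≤ r and ∫ w dν > 0; let g : ℝ → ℝ be differentiable, convex and nondecreasing on [0,B] with g(0) = 0, and let C : ℝ → ℝ be differentiable and convex on [0,s̄] with C'(s̄) = 0 and C'(s) ≥ −(Q/r)·∫ g dν for all s ∈ [0,s̄]. Then for every p ∈ [−B, s̄], writing x̄ = min{B, s̄−p} for the upper endpoint of the feasible interval I(p), one has g'(x̄) + C'(x̄ + p) ≥ 0 (so the derivative of the objective x ↦ g(x) + C(x+p) is nonnegative at the upper endpoint). -/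
open MeasureTheory

theorem upper_constraint_inactive_under_positive_drift
    (Q r B sbar : ℝ) (hQ : 0 < Q) (hr : 0 < r) (hB : 0 < B) (hsbar : 0 < sbar)
    (ν : Measure ℝ) [IsProbabilityMeasure ν] (hν : ν (Set.Icc 0 B) = 1)
    (hdrift : Q * ∫ w, w ∂ν ≤ r) (hmean : 0 < ∫ w, w ∂ν)
    (g : ℝ → ℝ) (hgd : Differentiable ℝ g) (hgconv : ConvexOn ℝ (Set.Icc 0 B) g)
    (hgmono : MonotoneOn g (Set.Icc 0 B)) (hg0 : g 0 = 0)
    (C : ℝ → ℝ) (hCd : Differentiable ℝ C) (hC : ConvexOn ℝ (Set.Icc 0 sbar) C)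
    (hCtop : deriv C sbar = 0)
    (hClb : ∀ s ∈ Set.Icc 0 sbar, -(Q / r) * ∫ w, g w ∂ν ≤ deriv C s) :
    ∀ p ∈ Set.Icc (-B) sbar,
      0 ≤ deriv g (min B (sbar - p)) + deriv C (min B (sbar - p) + p) := by
  have hae : ∀ᵐ w ∂ν, w ∈ Set.Icc 0 B := by
    rw [← prob_compl_eq_zero_iff measurableSet_Icc] at hν
    exact hν
  have hres : ν.restrict (Set.Icc 0 B) = ν := Measure.restrict_eq_self_of_ae_mem hae
  have hint : ∀ f : ℝ → ℝ, Continuous f → Integrable f ν := by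
    intro f hf
    have h : IntegrableOn f (Set.Icc 0 B) ν :=
      hf.continuousOn.integrableOn_compact isCompact_Icc
    rw [IntegrableOn, hres] at h
    exact h
  have hg' : ∀ x ∈ Set.Icc 0 B, 0 ≤ deriv g x := by
    intro x hx
    have h := hgmono.derivWithin_nonneg (x := x)
    rwa [(hgd x).derivWithin (uniqueDiffOn_Icc hB x hx)] at h
  have hBm : B ∈ Set.Icc 0 B := ⟨hB.le, le_rfl⟩
  have h0m : (0:ℝ) ∈ Set.Icc 0 B := ⟨le_rfl, hB.le⟩
  have hslope : g B ≤ deriv g B * B := by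
    have h := hgconv.slope_le_deriv h0m hBm hB (hgd B)
    rw [slope_def_field, hg0, sub_zero, sub_zero, div_le_iff₀ hB] at h
    exact h
  have hpt : ∀ w ∈ Set.Icc 0 B, g w ≤ deriv g B * w := by
    intro w hw
    have ha : 0 ≤ 1 - w / B := by rw [sub_nonneg, div_le_one hB]; exact hw.2
    have hb : 0 ≤ w / B := div_nonneg hw.1 hB.le
    have h := hgconv.2 h0m hBm ha hb (by ring)
    simp only [smul_eq_mul, mul_zero, zero_add, hg0] at h
    rw [div_mul_cancel₀ _ hB.ne'] at h
    have h2 := mul_le_mul_of_nonneg_left hslope (div_nonneg hw.1 hB.le)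
    have h3 : w / B * (deriv g B * B) = deriv g B * w := by field_simp
    linarith
  have hI : ∫ w, g w ∂ν ≤ deriv g B * ∫ w, w ∂ν := by
    rw [← integral_const_mul]
    exact integral_mono_ae (hint _ hgd.continuous) (hint _ (by fun_prop))
      (hae.mono fun w hw => hpt w hw)
  intro p hp
  rcases le_total B (sbar - p) with h | h
  · rw [min_eq_left h]
    have h1 := hClb (B + p) ⟨by linarith [hp.1], by linarith⟩
    have h2 : Q / r * ∫ w, g w ∂ν ≤ deriv g B := by
      rw [div_mul_eq_mul_div, div_le_iff₀ hr]
      have a := mul_le_mul_of_nonneg_left hI hQ.le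
      have b := mul_le_mul_of_nonneg_left hdrift (hg' B hBm)
      linarith
    linarith
  · rw [min_eq_right h, sub_add_cancel, hCtop, add_zero]
    exact hg' _ ⟨by linarith [hp.2], h⟩
end

section
/- Kernel monotonicity: assume Q·∫ w dν ≤ r and ∫ w dν > 0; let g : ℝ → ℝ be differentiable, strictly convex, and nondecreasing on [0,B] with g(0) = 0, and let C : ℝ → ℝ be differentiable and convex on [0,s̄] with C'(s̄) = 0 and C'(s) ≥ −(Q/r)·∫ g dν for all s ∈ [0,s̄]. Then the kernel φ satisfies −(p₂ − p₁) ≤ φ(p₂) − φ(p₁) ≤ 0 for all −B ≤ p₁ ≤ p₂ ≤ s̄; that is, φ is nonincreasing and p ↦ p + φ(p) is nondecreasing on [−B, s̄]. -/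
open MeasureTheory

theorem aux_convex {S : Set ℝ} {f : ℝ → ℝ} (hf : ConvexOn ℝ S f) {a b c d : ℝ}
    (ha : a ∈ S) (hd : d ∈ S) (hab : a ≤ b) (hac : a ≤ c) (had : a < d) (h : a + d = b + c) :
    f b + f c ≤ f a + f d := by
  have hpos : 0 < d - a := by linarith
  have w1 : 0 ≤ (d - b) / (d - a) := div_nonneg (by linarith) hpos.le
  have w2 : 0 ≤ (b - a) / (d - a) := div_nonneg (by linarith) hpos.le
  have w3 : (d - b) / (d - a) + (b - a) / (d - a) = 1 := by field_simp; ring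
  have h1 := hf.2 ha hd w1 w2 w3
  have h2 := hf.2 ha hd w2 w1 (by linarith)
  have e1 : (d - b) / (d - a) * a + (b - a) / (d - a) * d = b := by field_simp; ring
  have e2 : (b - a) / (d - a) * a + (d - b) / (d - a) * d = c := by
    have : c = a + d - b := by linarith
    subst this; field_simp; ring
  have e3 : (d - b) / (d - a) = 1 - (b - a) / (d - a) := by linarith
  simp only [smul_eq_mul, e1, e2] at h1 h2
  rw [e3] at h1 h2
  linarith

theorem aux_strict {S : Set ℝ} {f : ℝ → ℝ} (hf : StrictConvexOn ℝ S f) {a b c d : ℝ}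
    (ha : a ∈ S) (hd : d ∈ S) (hab : a < b) (hac : a < c) (h : a + d = b + c) :
    f b + f c < f a + f d := by
  have hpos : 0 < d - a := by linarith
  have had : a ≠ d := by intro h; linarith
  have w1 : 0 < (d - b) / (d - a) := div_pos (by linarith) hpos
  have w2 : 0 < (b - a) / (d - a) := div_pos (by linarith) hpos
  have w3 : (d - b) / (d - a) + (b - a) / (d - a) = 1 := by field_simp; ring
  have h1 := hf.2 ha hd had w1 w2 w3
  have h2 := hf.2 ha hd had w2 w1 (by linarith)
  have e1 : (d - b) / (d - a) * a + (b - a) / (d - a) * d = b := by field_simp; ring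
  have e2 : (b - a) / (d - a) * a + (d - b) / (d - a) * d = c := by
    have : c = a + d - b := by linarith
    subst this; field_simp; ring
  have e3 : (d - b) / (d - a) = 1 - (b - a) / (d - a) := by linarith
  simp only [smul_eq_mul, e1, e2] at h1 h2
  rw [e3] at h1 h2
  linarith

theorem kernel_monotonicity
    (Q r B sbar : ℝ) (hQ : 0 < Q) (hr : 0 < r) (hB : 0 < B) (hsbar : 0 < sbar)
    (ν : Measure ℝ) [IsProbabilityMeasure ν] (hν : ν (Set.Icc 0 B) = 1)
    (hdrift : Q * ∫ w, w ∂ν ≤ r) (hmean : 0 < ∫ w, w ∂ν)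
    (g : ℝ → ℝ) (hgd : Differentiable ℝ g) (hgconv : StrictConvexOn ℝ (Set.Icc 0 B) g)
    (hgmono : MonotoneOn g (Set.Icc 0 B)) (hg0 : g 0 = 0)
    (C : ℝ → ℝ) (hCd : Differentiable ℝ C) (hC : ConvexOn ℝ (Set.Icc 0 sbar) C)
    (hCtop : deriv C sbar = 0)
    (hClb : ∀ s ∈ Set.Icc 0 sbar, -(Q / r) * ∫ w, g w ∂ν ≤ deriv C s)
    (φ : ℝ → ℝ)
    (hφ : ∀ p ∈ Set.Icc (-B) sbar, φ p ∈ feasI B sbar p ∧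
      ∀ x ∈ feasI B sbar p, g (φ p) + C (φ p + p) ≤ g x + C (x + p)) :
    ∀ p₁ p₂ : ℝ, -B ≤ p₁ → p₁ ≤ p₂ → p₂ ≤ sbar →
      -(p₂ - p₁) ≤ φ p₂ - φ p₁ ∧ φ p₂ - φ p₁ ≤ 0 := by
  intro p₁ p₂ hp1 hp hp2
  obtain ⟨hx1, hm1⟩ := hφ p₁ ⟨hp1, hp.trans hp2⟩
  obtain ⟨hx2, hm2⟩ := hφ p₂ ⟨hp1.trans hp, hp2⟩
  have mem : ∀ p x, x ∈ feasI B sbar p ↔ (0 ≤ x ∧ -p ≤ x) ∧ (x ≤ B ∧ x ≤ sbar - p) := by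
    intro p x
    simp only [feasI, Set.mem_Icc, max_le_iff, le_min_iff]
  simp only [mem] at hx1 hx2 hm1 hm2
  generalize φ p₁ = x at *
  generalize φ p₂ = y at *
  obtain ⟨⟨a1, a2⟩, a3, a4⟩ := hx1
  obtain ⟨⟨b1, b2⟩, b3, b4⟩ := hx2
  constructor
  · by_contra hcon
    push Not at hcon
    rcases hp.eq_or_lt with heq | hlt
    · subst heq
      have k1 := hm1 y ⟨⟨b1, b2⟩, b3, b4⟩
      have k2 := hm2 ((y + x) / 2) (by refine ⟨⟨?_, ?_⟩, ?_, ?_⟩ <;> linarith)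
      have k3 := aux_strict hgconv (a := y) (d := x) (b := (y + x) / 2) (c := (y + x) / 2)
        ⟨b1, b3⟩ ⟨a1, a3⟩ (by linarith) (by linarith) (by ring)
      have k4 := aux_convex hC (a := y + p₁) (d := x + p₁) (b := (y + x) / 2 + p₁)
        (c := (y + x) / 2 + p₁) ⟨by linarith, by linarith⟩ ⟨by linarith, by linarith⟩
        (by linarith) (by linarith) (by linarith) (by ring)
      linarith
    · have k1 := hm1 (y + p₂ - p₁) (by refine ⟨⟨?_, ?_⟩, ?_, ?_⟩ <;> linarith)
      have k2 := hm2 (x + p₁ - p₂) (by refine ⟨⟨?_, ?_⟩, ?_, ?_⟩ <;> linarith)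
      have k3 := aux_strict hgconv (a := y) (d := x) (b := y + p₂ - p₁) (c := x + p₁ - p₂)
        ⟨b1, b3⟩ ⟨a1, a3⟩ (by linarith) (by linarith) (by ring)
      rw [sub_add_cancel] at k1 k2
      linarith
  · by_contra hcon
    push Not at hcon
    have k1 := hm1 ((x + y) / 2) (by refine ⟨⟨?_, ?_⟩, ?_, ?_⟩ <;> linarith)
    have k2 := hm2 x (by refine ⟨⟨?_, ?_⟩, ?_, ?_⟩ <;> linarith)
    have k3 := aux_strict hgconv (a := x) (d := y) (b := (x + y) / 2) (c := (x + y) / 2)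
      ⟨a1, a3⟩ ⟨b1, b3⟩ (by linarith) (by linarith) (by ring)
    have k4 := aux_convex hC (a := x + p₁) (d := y + p₁) (b := (x + y) / 2 + p₁)
      (c := (x + y) / 2 + p₁) ⟨by linarith, by linarith⟩ ⟨by linarith, by linarith⟩
      (by linarith) (by linarith) (by linarith) (by ring)
    have k5 := aux_convex hC (a := x + p₁) (d := y + p₂) (b := x + p₂)
      (c := y + p₁) ⟨by linarith, by linarith⟩ ⟨by linarith, by linarith⟩
      (by linarith) (by linarith) (by linarith) (by ring)
    linarith
end
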